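/- Let n ≥ 1, B > -(n-2)²/4, 0 ≤ A < n−1+2ρ with ρ = ((2-n)+√((n-2)²+4B))/2, α = (n+A−1+2ρ)/2, γ = n−1+2ρ, and fix β ∈ ℝ. Let f, g : ℝⁿ → ℝ be continuous with supports contained in the closed unit ball, and suppose ∫_{ℝⁿ} |x|^ρ ( g(x) + A|x|^{−1} f(x) ) dx > 0. Define, for λ > 1, C_{f,g}(λ,β) = ∫_{ℝⁿ} [ ( g(x) + A|x|^{−1} f(x) ) Ψ_β(0,x;λ) − f(x) ∂_tΨ_β(0,x;λ) ] dx, where Ψ_β(t,x;λ) = |x|^ρ (t+|x|+λ)^{−β} F(α,β,γ; 2|x|/(t+|x|+λ)) with F the hypergeometric function given by the Euler integral representation. Then there exists λ_β > 1 such that C_{f,g}(λ,β) > 0 for every λ > λ_β. -/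

import Mathlib

open MeasureTheory

/-- The hypergeometric function via the Euler integral representation,
`F(α,β,γ;z) = (Γ(γ)/(Γ(α)Γ(γ−α))) ∫₀¹ s^(α−1) (1−s)^(γ−α−1) (1−zs)^(−β) ds`,
valid for `γ > α > 0` and `z < 1`. -/
noncomputable def hyperF (α β γ z : ℝ) : ℝ :=
  (Real.Gamma γ / (Real.Gamma α * Real.Gamma (γ - α))) *
    ∫ s in (0 : ℝ)..1, s ^ (α - 1) * (1 - s) ^ (γ - α - 1) * (1 - z * s) ^ (-β)

/-- The test function `Ψ_β(t,x;λ) = |x|^ρ (t+|x|+λ)^(−β) F(α,β,γ; 2|x|/(t+|x|+λ))`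
on `ℝⁿ`. -/
noncomputable def Psi (n : ℕ) (α γ ρ β lam : ℝ) (t : ℝ)
    (x : EuclideanSpace ℝ (Fin n)) : ℝ :=
  ‖x‖ ^ ρ * (t + ‖x‖ + lam) ^ (-β) * hyperF α β γ (2 * ‖x‖ / (t + ‖x‖ + lam))

section

open Filter Topology Set

/-- The density `s^(α−1) (1−s)^(γ−α−1)` of the Euler integral. -/
noncomputable def eulerWeight (α γ s : ℝ) : ℝ := s ^ (α - 1) * (1 - s) ^ (γ - α - 1)

lemma measurable_eulerWeight (α γ : ℝ) : Measurable (eulerWeight α γ) := by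
  unfold eulerWeight
  fun_prop

lemma eulerWeight_pos (α γ : ℝ) {s : ℝ} (hs : s ∈ Ioo (0 : ℝ) 1) : 0 < eulerWeight α γ s :=
  mul_pos (Real.rpow_pos_of_pos hs.1 _) (Real.rpow_pos_of_pos (sub_pos.2 hs.2) _)

lemma eulerWeight_nonneg (α γ : ℝ) {s : ℝ} (hs : s ∈ Icc (0 : ℝ) 1) : 0 ≤ eulerWeight α γ s :=
  mul_nonneg (Real.rpow_nonneg hs.1 _) (Real.rpow_nonneg (sub_nonneg.2 hs.2) _)

lemma intervalIntegrable_eulerWeight {α γ : ℝ} (hα : 0 < α) (hγ : α < γ) :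
    IntervalIntegrable (eulerWeight α γ) volume 0 1 := by
  have h := (Complex.betaIntegral_convergent (u := (α : ℂ)) (v := ((γ - α : ℝ) : ℂ))
    (by simpa using hα) (by simpa using hγ)).norm
  refine h.congr_uIoo fun s hs => ?_
  rw [uIoo_of_le zero_le_one] at hs
  have h1 : ‖(s : ℂ) ^ ((α : ℂ) - 1)‖ = s ^ (α - 1) := by
    rw [Complex.norm_cpow_eq_rpow_re_of_pos hs.1]; simp
  have h2 : ‖(1 - (s : ℂ)) ^ (((γ - α : ℝ) : ℂ) - 1)‖ = (1 - s) ^ (γ - α - 1) := by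
    have : (1 - (s : ℂ)) = ((1 - s : ℝ) : ℂ) := by push_cast; ring
    rw [this, Complex.norm_cpow_eq_rpow_re_of_pos (sub_pos.2 hs.2)]; simp
  simp only [norm_mul, h1, h2, eulerWeight]

lemma integral_eulerWeight_pos {α γ : ℝ} (hα : 0 < α) (hγ : α < γ) :
    0 < ∫ s in (0 : ℝ)..1, eulerWeight α γ s :=
  intervalIntegral.intervalIntegral_pos_of_pos_on (intervalIntegrable_eulerWeight hα hγ)
    (fun _ hs => eulerWeight_pos α γ hs) zero_lt_one

lemma intervalIntegrable_eulerWeight_mul_rpow {α γ : ℝ} (hα : 0 < α) (hγ : α < γ) (b : ℝ)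
    {a c : ℝ} (h : ∀ s ∈ Icc (0 : ℝ) 1, 0 < a - c * s) :
    IntervalIntegrable (fun s => eulerWeight α γ s * (a - c * s) ^ b) volume 0 1 := by
  refine (intervalIntegrable_eulerWeight hα hγ).mul_continuousOn ?_
  rw [uIcc_of_le zero_le_one]
  exact ContinuousOn.rpow_const (by fun_prop) fun s hs => Or.inl (h s hs).ne'

lemma rpow_neg_mul_hyperF (α β γ : ℝ) {y r : ℝ} (hr : 0 ≤ r) (hy : 2 * r < y) :
    y ^ (-β) * hyperF α β γ (2 * r / y) =
      Real.Gamma γ / (Real.Gamma α * Real.Gamma (γ - α)) *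
        ∫ s in (0 : ℝ)..1, eulerWeight α γ s * (y - 2 * r * s) ^ (-β) := by
  have hy0 : 0 < y := by linarith
  rw [hyperF, mul_left_comm, ← intervalIntegral.integral_const_mul]
  congr 1
  refine intervalIntegral.integral_congr fun s hs => ?_
  rw [uIcc_of_le zero_le_one] at hs
  have h2 : 2 * r / y * s ≤ 1 := by
    rw [div_mul_eq_mul_div, div_le_one hy0]
    nlinarith [hs.1, hs.2]
  have h3 : y - 2 * r * s = y * (1 - 2 * r / y * s) := by field_simp
  simp only [eulerWeight]
  rw [h3, Real.mul_rpow hy0.le (by linarith)]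
  ring

lemma hasDerivAt_integral_eulerWeight_mul_rpow {α γ : ℝ} (hα : 0 < α) (hγ : α < γ) (b : ℝ)
    {a c : ℝ} (hc : 0 ≤ c) (hac : c < a) :
    HasDerivAt (fun t => ∫ s in (0 : ℝ)..1, eulerWeight α γ s * (t + a - c * s) ^ b)
      (∫ s in (0 : ℝ)..1, eulerWeight α γ s * (b * (a - c * s) ^ (b - 1))) 0 := by
  have hδ : 0 < (a - c) / 2 := by linarith
  have hlow : ∀ s ∈ Icc (0 : ℝ) 1, ∀ t ∈ Metric.ball (0 : ℝ) ((a - c) / 2),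
      t + a - c * s ∈ Icc ((a - c) / 2) (2 * a) := by
    intro s hs t ht
    rw [mem_ball_zero_iff, Real.norm_eq_abs, abs_lt] at ht
    constructor <;> nlinarith [hs.1, hs.2]
  obtain ⟨M, hM⟩ := (isCompact_Icc (a := (a - c) / 2) (b := 2 * a)).exists_bound_of_continuousOn
    (f := fun y : ℝ => b * y ^ (b - 1))
    (continuousOn_const.mul (continuousOn_id.rpow_const
      fun y hy => Or.inl (hδ.trans_le hy.1).ne'))
  have hsub : ∀ {s : ℝ}, s ∈ uIoc (0 : ℝ) 1 → s ∈ Icc (0 : ℝ) 1 := fun {s} hs => by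
    rw [uIoc_of_le zero_le_one] at hs
    exact Ioc_subset_Icc_self hs
  have hmeas := measurable_eulerWeight α γ
  have key := intervalIntegral.hasDerivAt_integral_of_dominated_loc_of_deriv_le (μ := volume)
    (a := 0) (b := 1) (x₀ := (0 : ℝ))
    (F := fun t s => eulerWeight α γ s * (t + a - c * s) ^ b)
    (F' := fun t s => eulerWeight α γ s * (b * (t + a - c * s) ^ (b - 1)))
    (bound := fun s => eulerWeight α γ s * M)
    (Metric.ball_mem_nhds 0 hδ)
    (Eventually.of_forall fun t => (by fun_prop : Measurable _).aestronglyMeasurable)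
    (intervalIntegrable_eulerWeight_mul_rpow hα hγ b fun s hs =>
      hδ.trans_le (hlow s hs 0 (Metric.mem_ball_self hδ)).1)
    ((by fun_prop : Measurable _).aestronglyMeasurable)
    (ae_of_all _ fun s hs t ht => ?_)
    ((intervalIntegrable_eulerWeight hα hγ).mul_const M)
    (ae_of_all _ fun s hs t ht => ?_)
  · simpa using key.2
  · rw [norm_mul, Real.norm_of_nonneg (eulerWeight_nonneg α γ (hsub hs))]
    exact mul_le_mul_of_nonneg_left (hM _ (hlow s (hsub hs) t ht))
      (eulerWeight_nonneg α γ (hsub hs))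
  · have h0 : t + a - c * s ≠ 0 := (hδ.trans_le (hlow s (hsub hs) t ht).1).ne'
    have h1 : HasDerivAt (fun t : ℝ => t + a - c * s) 1 t :=
      ((hasDerivAt_id t).add_const a).sub_const _
    have h2 := (h1.rpow_const (p := b) (Or.inl h0)).const_mul (eulerWeight α γ s)
    simpa only [one_mul] using h2

lemma exists_abs_rpow_mul_add_rpow_neg_sub_one_le (b : ℝ) {ε : ℝ} (hε : 0 < ε) :
    ∃ Λ : ℝ, ∀ lam > Λ, ∀ q : ℝ, |q| ≤ 1 → |lam ^ b * (lam + q) ^ (-b) - 1| ≤ ε := by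
  have hcont : ContinuousAt (fun y : ℝ => y ^ (-b)) 1 :=
    continuousAt_id.rpow_const (Or.inl one_ne_zero)
  obtain ⟨δ, hδ, h⟩ := Metric.continuousAt_iff.1 hcont ε hε
  refine ⟨max 1 (1 / δ), fun lam hlam q hq => ?_⟩
  have h1 : 1 < lam := (le_max_left _ _).trans_lt hlam
  have h0 : 0 < lam := by linarith
  have h2 : 1 / lam < δ := by
    rw [div_lt_comm₀ h0 hδ]
    exact (le_max_right _ _).trans_lt hlam
  have hd : dist (1 + q / lam) 1 < δ := by
    rw [Real.dist_eq, add_sub_cancel_left, abs_div, abs_of_pos h0]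
    exact (div_le_div_of_nonneg_right hq h0.le).trans_lt h2
  have h3 := (h hd).le
  rw [Real.dist_eq, Real.one_rpow] at h3
  have h4 : lam + q = lam * (1 + q / lam) := by field_simp
  have h5 : 0 ≤ 1 + q / lam := by
    have : -1 ≤ q / lam := by
      rw [le_div_iff₀ h0]
      linarith [(abs_le.1 hq).1]
    linarith
  rwa [h4, Real.mul_rpow h0.le h5, ← mul_assoc, ← Real.rpow_add h0, add_neg_cancel,
    Real.rpow_zero, one_mul]

lemma exists_abs_rpow_mul_integral_sub_le {α γ : ℝ} (hα : 0 < α) (hγ : α < γ) (b : ℝ) {ε : ℝ}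
    (hε : 0 < ε) :
    ∃ Λ : ℝ, ∀ lam > Λ, ∀ r ∈ Icc (0 : ℝ) 1,
      |lam ^ b * (∫ s in (0 : ℝ)..1, eulerWeight α γ s * (r + lam - 2 * r * s) ^ (-b))
        - ∫ s in (0 : ℝ)..1, eulerWeight α γ s| ≤ ε * ∫ s in (0 : ℝ)..1, eulerWeight α γ s := by
  obtain ⟨Λ, hΛ⟩ := exists_abs_rpow_mul_add_rpow_neg_sub_one_le b hε
  refine ⟨max 1 Λ, fun lam hlam r hr => ?_⟩
  have h1 : 1 < lam := (le_max_left _ _).trans_lt hlam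
  have hw := intervalIntegrable_eulerWeight hα hγ
  have hi := intervalIntegrable_eulerWeight_mul_rpow hα hγ (-b) (a := r + lam) (c := 2 * r)
    fun s hs => by nlinarith [hs.1, hs.2, hr.1, hr.2]
  rw [← intervalIntegral.integral_const_mul, ← intervalIntegral.integral_sub (hi.const_mul _) hw,
    ← intervalIntegral.integral_const_mul, ← Real.norm_eq_abs]
  refine intervalIntegral.norm_integral_le_of_norm_le zero_le_one
    (ae_of_all _ fun s hs => ?_) (hw.const_mul ε)
  have hs' := Ioc_subset_Icc_self hs
  have hq : |r - 2 * r * s| ≤ 1 := by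
    rw [abs_le]
    constructor <;> nlinarith [hs'.1, hs'.2, hr.1, hr.2]
  have h2 := hΛ lam ((le_max_right _ _).trans_lt hlam) _ hq
  have h3 : lam ^ b * (eulerWeight α γ s * (r + lam - 2 * r * s) ^ (-b)) - eulerWeight α γ s =
      (lam ^ b * (lam + (r - 2 * r * s)) ^ (-b) - 1) * eulerWeight α γ s := by
    rw [show r + lam - 2 * r * s = lam + (r - 2 * r * s) by ring]
    ring
  rw [h3, norm_mul, Real.norm_of_nonneg (eulerWeight_nonneg α γ hs'), Real.norm_eq_abs]
  exact mul_le_mul_of_nonneg_right h2 (eulerWeight_nonneg α γ hs')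

lemma integrable_norm_rpow_mul {n : ℕ} (hn : 1 ≤ n) {ρ : ℝ} (hρ : -(n : ℝ) < ρ)
    {f : EuclideanSpace ℝ (Fin n) → ℝ} (hf : Continuous f)
    (hsupp : Function.support f ⊆ Metric.closedBall 0 1) :
    Integrable (fun x => ‖x‖ ^ ρ * f x) := by
  have : Nonempty (Fin n) := ⟨⟨0, hn⟩⟩
  have hball : IntegrableOn (fun x : EuclideanSpace ℝ (Fin n) => ‖x‖ ^ ρ)
      (Metric.ball 0 2) := by
    rw [integrableOn_fun_norm_addHaar volume (f := fun y : ℝ => y ^ ρ)]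
    have h := (intervalIntegral.integrableOn_Ioo_rpow_iff (s := (n : ℝ) - 1 + ρ)
      (t := 2) two_pos).2 (by linarith)
    refine h.congr_fun (fun y hy => ?_) measurableSet_Ioo
    simp only [finrank_euclideanSpace, Fintype.card_fin, smul_eq_mul]
    rw [Real.rpow_add hy.1, ← Real.rpow_natCast, Nat.cast_sub hn, Nat.cast_one]
  obtain ⟨M, hM⟩ := (isCompact_closedBall (0 : EuclideanSpace ℝ (Fin n)) 2)
    |>.exists_bound_of_continuousOn hf.continuousOn
  have h := Integrable.mul_bdd (c := M) hball hf.aestronglyMeasurable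
    ((ae_restrict_iff' Metric.isOpen_ball.measurableSet).2
      (ae_of_all _ fun x hx => hM x (Metric.ball_subset_closedBall hx)))
  refine (integrableOn_iff_integrable_of_support_subset ?_).1 h
  exact (Function.support_mul_subset_right _ _).trans
    (hsupp.trans (Metric.closedBall_subset_ball one_lt_two))

lemma Psi_eq_integral (n : ℕ) (α γ ρ β lam t : ℝ) {x : EuclideanSpace ℝ (Fin n)}
    (h : ‖x‖ < t + lam) :
    Psi n α γ ρ β lam t x = ‖x‖ ^ ρ * (Real.Gamma γ / (Real.Gamma α * Real.Gamma (γ - α)) *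
      ∫ s in (0 : ℝ)..1, eulerWeight α γ s * (t + (‖x‖ + lam) - 2 * ‖x‖ * s) ^ (-β)) := by
  rw [Psi, mul_assoc, rpow_neg_mul_hyperF α β γ (norm_nonneg x) (by linarith), add_assoc]

lemma deriv_Psi {n : ℕ} {α γ : ℝ} (hα : 0 < α) (hγ : α < γ) (ρ β lam : ℝ)
    {x : EuclideanSpace ℝ (Fin n)} (h : ‖x‖ < lam) :
    deriv (fun t => Psi n α γ ρ β lam t x) 0 =
      -β * (‖x‖ ^ ρ * (Real.Gamma γ / (Real.Gamma α * Real.Gamma (γ - α)) *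
        ∫ s in (0 : ℝ)..1, eulerWeight α γ s * (‖x‖ + lam - 2 * ‖x‖ * s) ^ (-(β + 1)))) := by
  have hev : (fun t => Psi n α γ ρ β lam t x) =ᶠ[𝓝 0] fun t =>
      ‖x‖ ^ ρ * (Real.Gamma γ / (Real.Gamma α * Real.Gamma (γ - α)) *
      ∫ s in (0 : ℝ)..1, eulerWeight α γ s * (t + (‖x‖ + lam) - 2 * ‖x‖ * s) ^ (-β)) := by
    filter_upwards [lt_mem_nhds (sub_neg.2 h)] with t ht
    exact Psi_eq_integral n α γ ρ β lam t (by linarith)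
  rw [hev.deriv_eq, (((hasDerivAt_integral_eulerWeight_mul_rpow hα hγ (-β)
    (c := 2 * ‖x‖) (a := ‖x‖ + lam) (by positivity) (by linarith)).const_mul _).const_mul _).deriv]
  simp only [mul_left_comm _ (-β) _, intervalIntegral.integral_const_mul]
  rw [neg_add']

lemma measurable_integral_eulerWeight_mul_rpow (n : ℕ) (α γ lam b : ℝ) :
    Measurable fun x : EuclideanSpace ℝ (Fin n) =>
      ∫ s in (0 : ℝ)..1, eulerWeight α γ s * (‖x‖ + lam - 2 * ‖x‖ * s) ^ b := by
  simp only [intervalIntegral.integral_of_le zero_le_one]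
  have hmeas := measurable_eulerWeight α γ
  exact (StronglyMeasurable.integral_prod_right
    (f := fun (x : EuclideanSpace ℝ (Fin n)) (s : ℝ) =>
      eulerWeight α γ s * (‖x‖ + lam - 2 * ‖x‖ * s) ^ b)
    (by simp only [Function.uncurry_def]; fun_prop : Measurable _).stronglyMeasurable).measurable

/-- If `G` is close to a positive constant `K` and `H` is close to `0`, then `h G + k H` has
positive integral as soon as `h` does. -/
lemma exists_pos_forall_integral_mul_add_mul_pos {X : Type*} [MeasurableSpace X]
    {μ : Measure X} {h k : X → ℝ} (hh : Integrable h μ) (hk : Integrable k μ)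
    (hpos : 0 < ∫ x, h x ∂μ) :
    ∃ ε > 0, ∀ K > 0, ∀ G H : X → ℝ, Measurable G → Measurable H →
      (∀ x, |h x * (G x - K)| ≤ |h x| * (ε * K)) → (∀ x, |k x * H x| ≤ |k x| * (ε * K)) →
      0 < ∫ x, (h x * G x + k x * H x) ∂μ := by
  have hN : 0 ≤ ∫ x, (|h x| + |k x|) ∂μ := integral_nonneg fun x => by positivity
  set N := ∫ x, (|h x| + |k x|) ∂μ with hNdef
  set P := ∫ x, h x ∂μ
  refine ⟨P / (N + 1), by positivity, fun K hK G H hG hH hGK hHK => ?_⟩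
  set ε := P / (N + 1) with hε
  have hε0 : 0 < ε := by positivity
  have hlt : ε * N < P := by
    rw [hε, div_mul_eq_mul_div, div_lt_iff₀ (by positivity)]
    nlinarith
  have i1 : Integrable (fun x => h x * (G x - K)) μ :=
    (hh.abs.mul_const (ε * K)).mono' (hh.1.mul (hG.sub_const K).aestronglyMeasurable)
      (ae_of_all _ hGK)
  have i2 : Integrable (fun x => k x * H x) μ :=
    (hk.abs.mul_const (ε * K)).mono' (hk.1.mul hH.aestronglyMeasurable) (ae_of_all _ hHK)
  have i3 : Integrable (fun x => h x * G x + k x * H x) μ := by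
    refine ((i1.add (hh.mul_const K)).add i2).congr (ae_of_all _ fun x => ?_)
    simp only [Pi.add_apply]
    ring
  have i4 : Integrable (fun x => |h x| + |k x|) μ := hh.abs.add hk.abs
  have hle : ∫ x, (h x * K - (|h x| + |k x|) * (ε * K)) ∂μ ≤
      ∫ x, (h x * G x + k x * H x) ∂μ := by
    refine integral_mono ((hh.mul_const K).sub (i4.mul_const _)) i3 fun x => ?_
    have h1 := (abs_le.1 (hGK x)).1
    have h2 := (abs_le.1 (hHK x)).1
    simp only
    linarith
  refine lt_of_lt_of_le ?_ hle
  rw [integral_sub (hh.mul_const K) (i4.mul_const _), integral_mul_const,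
    integral_mul_const, ← hNdef]
  nlinarith

end

/-- for continuous `f, g` supported in the closed unit ball with
`∫ |x|^ρ (g + A|x|⁻¹ f) dx > 0`, there is `λ_β > 1` such that
`C_(f,g)(λ,β) = ∫ ((g + A|x|⁻¹f) Ψ_β(0,x;λ) − f ∂_tΨ_β(0,x;λ)) dx > 0`
for every `λ > λ_β`. -/
theorem stmt12 (n : ℕ) (hn : 1 ≤ n) (A B : ℝ)
    (hB : -((n : ℝ) - 2) ^ 2 / 4 < B)
    (ρ : ℝ) (hρ : ρ = ((2 - (n : ℝ)) + Real.sqrt (((n : ℝ) - 2) ^ 2 + 4 * B)) / 2)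
    (hA0 : 0 ≤ A) (hA1 : A < (n : ℝ) - 1 + 2 * ρ)
    (α γ : ℝ) (hα : α = ((n : ℝ) + A - 1 + 2 * ρ) / 2) (hγ : γ = (n : ℝ) - 1 + 2 * ρ)
    (β : ℝ)
    (f g : EuclideanSpace ℝ (Fin n) → ℝ) (hf : Continuous f) (hg : Continuous g)
    (hsuppf : Function.support f ⊆ Metric.closedBall 0 1)
    (hsuppg : Function.support g ⊆ Metric.closedBall 0 1)
    (hpos : 0 < ∫ x : EuclideanSpace ℝ (Fin n), ‖x‖ ^ ρ * (g x + A * ‖x‖⁻¹ * f x)) :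
    ∃ lamβ : ℝ, 1 < lamβ ∧ ∀ lam : ℝ, lamβ < lam →
      0 < ∫ x : EuclideanSpace ℝ (Fin n),
        ((g x + A * ‖x‖⁻¹ * f x) * Psi n α γ ρ β lam 0 x
          - f x * deriv (fun t => Psi n α γ ρ β lam t x) 0) := by
  have hsq : 0 < Real.sqrt (((n : ℝ) - 2) ^ 2 + 4 * B) := Real.sqrt_pos.2 (by linarith)
  have hnρ : -(n : ℝ) < ρ := by
    rw [hρ]
    have : (1 : ℝ) ≤ n := by exact_mod_cast hn
    linarith
  have hα0 : 0 < α := by linarith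
  have hαγ : α < γ := by linarith
  have hh : Integrable fun x : EuclideanSpace ℝ (Fin n) => ‖x‖ ^ ρ * (g x + A * ‖x‖⁻¹ * f x) := by
    by_contra hcon
    rw [integral_undef hcon] at hpos
    exact hpos.false
  have hk : Integrable fun x : EuclideanSpace ℝ (Fin n) => β * (‖x‖ ^ ρ * f x) :=
    (integrable_norm_rpow_mul hn hnρ hf hsuppf).const_mul β
  obtain ⟨ε, hε, hmain⟩ := exists_pos_forall_integral_mul_add_mul_pos hh hk hpos
  obtain ⟨Λ₁, hΛ₁⟩ := exists_abs_rpow_mul_integral_sub_le hα0 hαγ β hε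
  obtain ⟨Λ₂, hΛ₂⟩ := exists_abs_rpow_mul_integral_sub_le hα0 hαγ (β + 1) one_pos
  have hW := integral_eulerWeight_pos hα0 hαγ
  set W := ∫ s in (0 : ℝ)..1, eulerWeight α γ s
  have hc : 0 < Real.Gamma γ / (Real.Gamma α * Real.Gamma (γ - α)) :=
    div_pos (Real.Gamma_pos_of_pos (hα0.trans hαγ))
      (mul_pos (Real.Gamma_pos_of_pos hα0) (Real.Gamma_pos_of_pos (sub_pos.2 hαγ)))
  refine ⟨max 2 (max (2 / ε) (max Λ₁ Λ₂)), one_lt_two.trans_le (le_max_left _ _),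
    fun lam hlam => ?_⟩
  simp only [max_lt_iff] at hlam
  obtain ⟨hlam2, hlamε, hlam₁, hlam₂⟩ := hlam
  have hlam0 : 0 < lam := by linarith
  have hpow : 0 < lam ^ β := Real.rpow_pos_of_pos hlam0 β
  set c := Real.Gamma γ / (Real.Gamma α * Real.Gamma (γ - α)) with hcdef
  have key := hmain W hW
    (fun x => lam ^ β * ∫ s in (0 : ℝ)..1,
      eulerWeight α γ s * (‖x‖ + lam - 2 * ‖x‖ * s) ^ (-β))
    (fun x => lam ^ β * ∫ s in (0 : ℝ)..1,
      eulerWeight α γ s * (‖x‖ + lam - 2 * ‖x‖ * s) ^ (-(β + 1)))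
    ((measurable_integral_eulerWeight_mul_rpow n α γ lam _).const_mul _)
    ((measurable_integral_eulerWeight_mul_rpow n α γ lam _).const_mul _)
    (fun x => ?_) (fun x => ?_)
  · have heq : ∀ x : EuclideanSpace ℝ (Fin n),
        (g x + A * ‖x‖⁻¹ * f x) * Psi n α γ ρ β lam 0 x
          - f x * deriv (fun t => Psi n α γ ρ β lam t x) 0 =
        (c / lam ^ β) * (‖x‖ ^ ρ * (g x + A * ‖x‖⁻¹ * f x) * (lam ^ β * ∫ s in (0 : ℝ)..1,
            eulerWeight α γ s * (‖x‖ + lam - 2 * ‖x‖ * s) ^ (-β)) +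
          β * (‖x‖ ^ ρ * f x) * (lam ^ β * ∫ s in (0 : ℝ)..1,
            eulerWeight α γ s * (‖x‖ + lam - 2 * ‖x‖ * s) ^ (-(β + 1)))) := by
      intro x
      by_cases hx : x ∈ Metric.closedBall (0 : EuclideanSpace ℝ (Fin n)) 1
      · rw [mem_closedBall_zero_iff] at hx
        rw [Psi_eq_integral n α γ ρ β lam 0 (by linarith),
          deriv_Psi hα0 hαγ ρ β lam (by linarith), zero_add, ← hcdef]
        field_simp
        ring
      · have hfx : f x = 0 := Function.notMem_support.1 fun h => hx (hsuppf h)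
        have hgx : g x = 0 := Function.notMem_support.1 fun h => hx (hsuppg h)
        simp [hfx, hgx]
    simp only [heq]
    rw [integral_const_mul]
    exact mul_pos (div_pos hc hpow) key
  · by_cases hx : x ∈ Metric.closedBall (0 : EuclideanSpace ℝ (Fin n)) 1
    · rw [mem_closedBall_zero_iff] at hx
      rw [abs_mul]
      exact mul_le_mul_of_nonneg_left (hΛ₁ lam hlam₁ ‖x‖ ⟨norm_nonneg x, hx⟩) (abs_nonneg _)
    · have hfx : f x = 0 := Function.notMem_support.1 fun h => hx (hsuppf h)
      have hgx : g x = 0 := Function.notMem_support.1 fun h => hx (hsuppg h)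
      simp [hfx, hgx]
  · by_cases hx : x ∈ Metric.closedBall (0 : EuclideanSpace ℝ (Fin n)) 1
    · rw [mem_closedBall_zero_iff] at hx
      rw [abs_mul]
      refine mul_le_mul_of_nonneg_left ?_ (abs_nonneg _)
      have h2 := abs_le.1 (hΛ₂ lam hlam₂ ‖x‖ ⟨norm_nonneg x, hx⟩)
      rw [Real.rpow_add_one hlam0.ne'] at h2
      set J := ∫ s in (0 : ℝ)..1, eulerWeight α γ s * (‖x‖ + lam - 2 * ‖x‖ * s) ^ (-(β + 1))
      have h3 : lam * (lam ^ β * J) ≤ 2 * W := by linarith [h2.2]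
      have h4 : 0 ≤ lam * (lam ^ β * J) := by linarith [h2.1]
      have h5 : 2 ≤ lam * ε := ((div_lt_iff₀ hε).1 hlamε).le
      rw [abs_of_nonneg (nonneg_of_mul_nonneg_right h4 hlam0)]
      refine le_of_mul_le_mul_left (h3.trans ?_) hlam0
      rw [← mul_assoc]
      exact mul_le_mul_of_nonneg_right h5 hW.le
    · have hfx : f x = 0 := Function.notMem_support.1 fun h => hx (hsuppf h)
      simp [hfx]
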